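/- arXiv:1403.5181 — 2 statements merged into one kernel-verified Lean document; each statement's English description precedes it below -/
import Mathlib

section
/- Let f : ℝ → ℝ be a continuous function which is periodic, i.e., there exists c > 0 with f(x + c) = f(x) for all x ∈ ℝ. If there exists a nonzero polynomial P in two variables with real coefficients such that P(x, f(x)) = 0 for all x ∈ ℝ, then f is constant. -/
open MvPolynomial in
/-- If `P(x + n c, y) = 0` for all natural `n`, with `c ≠ 0`, then `P(·, y)` vanishes. -/
theorem eval_eq_zero_of_forall_eval_add_nat_mul_eq_zero {R : Type*} [CommRing R] [IsDomain R]
    [CharZero R] {P : MvPolynomial (Fin 2) R} {x c y : R} (hc : c ≠ 0)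
    (h : ∀ n : ℕ, eval ![x + n * c, y] P = 0) (t : R) : eval ![t, y] P = 0 := by
  have key (s : R) : eval ![s, y] P =
      Polynomial.eval s (Polynomial.map (eval ![y]) (finSuccEquiv R 1 P)) :=
    eval_eq_eval_mv_eval' ![y] s P
  have hinj : Function.Injective fun n : ℕ ↦ x + n * c := fun m n hmn ↦ by
    simpa [hc] using hmn
  have hzero : Polynomial.map (eval ![y]) (finSuccEquiv R 1 P) = 0 := by
    refine Polynomial.eq_zero_of_infinite_isRoot _ ((Set.infinite_range_of_injective hinj).mono ?_)
    rintro _ ⟨n, rfl⟩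
    exact (key _).symm.trans (h n)
  rw [key, hzero, Polynomial.eval_zero]

/-- A periodic continuous function on `ℝ` satisfying a nontrivial polynomial equation
`P(x, f(x)) = 0` is constant. -/
theorem periodic_algebraic_function_is_constant (f : ℝ → ℝ)
    (hcont : Continuous f)
    (hper : ∃ c : ℝ, 0 < c ∧ ∀ x : ℝ, f (x + c) = f x)
    (halg : ∃ P : MvPolynomial (Fin 2) ℝ, P ≠ 0 ∧
      ∀ x : ℝ, MvPolynomial.eval ![x, f x] P = 0) :
    ∃ a : ℝ, ∀ x : ℝ, f x = a := by
  obtain ⟨c, hc, hper⟩ := hper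
  obtain ⟨P, hP, halg⟩ := halg
  have hvanish (x t : ℝ) : MvPolynomial.eval ![t, f x] P = 0 := by
    refine eval_eq_zero_of_forall_eval_add_nat_mul_eq_zero hc.ne' (x := x) (fun n ↦ ?_) t
    have hn : f (x + n * c) = f x := Function.Periodic.nat_mul hper n x
    simpa only [hn] using halg (x + n * c)
  by_contra! hne
  obtain ⟨x, hx⟩ := hne (f 0)
  have hinf : (Set.range f).Infinite :=
    (isPreconnected_range hcont).infinite_of_nontrivial
      ⟨f x, Set.mem_range_self x, f 0, Set.mem_range_self 0, hx⟩
  refine hP (MvPolynomial.funext_set ![Set.univ, Set.range f] ?_ fun v hv ↦ ?_)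
  · simp [Fin.forall_fin_two, Set.infinite_univ, hinf]
  · obtain ⟨y, hy⟩ : v 1 ∈ Set.range f := hv 1 (Set.mem_univ 1)
    have hv' : v = ![v 0, f y] := by
      ext i; fin_cases i <;> simp [hy]
    rw [hv', hvanish, map_zero]
end

section
/- Let U be an open subset of ℝ^m, let 1 ≤ c ≤ m, let C = {x ∈ U : x₁ = ⋯ = x_c = 0}, and let D = {(x, v) ∈ U × (ℝ^c ∖ {0}) : x_i v_j = x_j v_i for all 1 ≤ i, j ≤ c}. Then the subset {(x, v) ∈ D : (x₁, …, x_c) ≠ 0} is dense in D; equivalently, D ∖ (C × (ℝ^c ∖ {0})) is dense in D. -/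
open Topology Filter in
/-- Density of the part lying over the complement of the center in the incidence
variety defining the blow-up of an open set `U ⊆ ℝ^m` with center
`C = {x₁ = ⋯ = x_c = 0}`. -/
theorem blowup_incidence_variety_dense_off_center {m c : ℕ}
    (hc : 1 ≤ c) (hcm : c ≤ m)
    (U : Set (Fin m → ℝ)) (hU : IsOpen U)
    (D : Set ((Fin m → ℝ) × (Fin c → ℝ)))
    (hD : D = {p | p.1 ∈ U ∧ p.2 ≠ 0 ∧
      ∀ i j : Fin c, p.1 (Fin.castLE hcm i) * p.2 j = p.1 (Fin.castLE hcm j) * p.2 i}) :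
    D ⊆ closure (D \ {p | ∀ i : Fin c, p.1 (Fin.castLE hcm i) = 0}) := by
  subst hD
  rintro ⟨x, v⟩ hxv
  by_cases hx : ∀ i : Fin c, x (Fin.castLE hcm i) = 0
  swap
  · exact subset_closure ⟨hxv, hx⟩
  obtain ⟨hxU, hv, -⟩ := hxv
  -- Approach `(x, v)` along the line through `x` in the direction `v`, extended by zero.
  let w : Fin m → ℝ := fun k ↦ if h : (k : ℕ) < c then v ⟨k, h⟩ else 0
  have hw (i : Fin c) : w (Fin.castLE hcm i) = v i := by simp [w]
  have hlim : Tendsto (fun t : ℝ ↦ x + t • w) (𝓝[≠] 0) (𝓝 x) := by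
    have hcont : Continuous fun t : ℝ ↦ x + t • w := by fun_prop
    simpa using (hcont.tendsto 0).mono_left nhdsWithin_le_nhds
  refine mem_closure_of_tendsto (hlim.prodMk_nhds tendsto_const_nhds) ?_
  filter_upwards [hlim.eventually (hU.mem_nhds hxU), self_mem_nhdsWithin] with t htU ht
  refine ⟨⟨htU, hv, fun i j ↦ ?_⟩, fun h ↦ hv ?_⟩
  · simp only [Pi.add_apply, Pi.smul_apply, smul_eq_mul, hw, hx]
    ring
  · funext i
    simpa [hw, hx, show t ≠ 0 from ht] using h i
end
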